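/- Let χ > 0, assume (B) and (init), and let (u, v) be the maximal classical solution of the crime model on Ω̄ × [0, T_max). For all T > 0 there exists C(T) > 0 such that, with T̂_max := min{T, T_max}, ∫_Ω u(·,t) ≤ C(T) for all t ∈ (0, T̂_max), and sup_{T>0} C(T) < ∞ if either hypothesis (H1) or hypothesis (H2) holds. Moreover, for all T > 0 and each ξ ∈ (0,T) there exists K(T,ξ) > 0 such that ∫_t^{t+ξ} ∫_Ω uv ≤ K(T,ξ) for all t ∈ (0, T̂_max − ξ); here sup_{T>ξ} K(T,ξ) < ∞ for every ξ > 0 if (H2) holds, and sup_{T>0} sup_{ξ∈(0,T)} K(T,ξ) < ∞ if (H1) holds. -/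

import Mathlib

open Real MeasureTheory Filter Topology Set
open scoped ENNReal NNReal

noncomputable section

/-- Partial derivative of a space-time function in the first (space) variable. -/
def pdx (f : ℝ → ℝ → ℝ) : ℝ → ℝ → ℝ := fun x t => deriv (fun y => f y t) x

/-- Partial derivative of a space-time function in the second (time) variable. -/
def pdt (f : ℝ → ℝ → ℝ) : ℝ → ℝ → ℝ := fun x t => deriv (fun s => f x s) t

/-- The time interval `[0, Tmax)` (with `Tmax ∈ (0,∞]`). -/
def It (Tmax : ℝ≥0∞) : Set ℝ := {t : ℝ | 0 ≤ t ∧ ENNReal.ofReal t < Tmax}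

/-- The time interval `(0, Tmax)` (with `Tmax ∈ (0,∞]`). -/
def It' (Tmax : ℝ≥0∞) : Set ℝ := {t : ℝ | 0 < t ∧ ENNReal.ofReal t < Tmax}

/-- The waiting time `τ := min{1, Tmax/3}`, as a real number. -/
def tauOf (Tmax : ℝ≥0∞) : ℝ := (min 1 (Tmax / 3)).toReal

/-- Hypothesis (B): `B` is nonnegative, bounded, and locally Hölder continuous on
`Ω̄ × [0,∞)` with some exponent `ϑ ∈ (0,1)`. -/
def HypB (a b : ℝ) (B : ℝ → ℝ → ℝ) : Prop :=
  (∀ x t : ℝ, 0 ≤ B x t) ∧ (∃ M : ℝ, ∀ x t : ℝ, B x t ≤ M) ∧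
  ∃ ϑ : ℝ, ϑ ∈ Set.Ioo (0:ℝ) 1 ∧
    ∀ K : Set (ℝ × ℝ), IsCompact K → K ⊆ (Set.Icc a b) ×ˢ (Set.Ici (0:ℝ)) →
      ∃ C : ℝ, ∀ p ∈ K, ∀ q ∈ K, |B p.1 p.2 - B q.1 q.2| ≤ C * dist p q ^ ϑ

/-- Hypothesis (init): `u0 ∈ C⁰(Ω̄)` nonnegative, `v0 ∈ W^{1,∞}(Ω)` (i.e. Lipschitz)
positive on `Ω̄`. -/
def HypInit (a b : ℝ) (u0 v0 : ℝ → ℝ) : Prop :=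
  ContinuousOn u0 (Set.Icc a b) ∧ (∀ x ∈ Set.Icc a b, 0 ≤ u0 x) ∧
  (∃ L : ℝ≥0, LipschitzOnWith L v0 (Set.Icc a b)) ∧ (∀ x ∈ Set.Icc a b, 0 < v0 x)

/-- Hypothesis (H1): `∫_0^∞ ∫_Ω B1 < ∞`. -/
def HypH1 (a b : ℝ) (B1 : ℝ → ℝ → ℝ) : Prop :=
  MeasureTheory.IntegrableOn (fun p : ℝ × ℝ => B1 p.1 p.2)
    ((Set.Ioo a b) ×ˢ (Set.Ioi (0:ℝ)))

/-- Hypothesis (H1'): `∫_t^{t+1} ∫_Ω B1 → 0` as `t → ∞`. -/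
def HypH1' (a b : ℝ) (B1 : ℝ → ℝ → ℝ) : Prop :=
  Filter.Tendsto (fun t : ℝ => ∫ s in t..(t+1), ∫ x in Set.Ioo a b, B1 x s)
    Filter.atTop (nhds 0)

/-- Hypothesis (H2): `inf_{t>0} ∫_Ω B2(·,t) > 0`. -/
def HypH2 (a b : ℝ) (B2 : ℝ → ℝ → ℝ) : Prop :=
  ∃ c : ℝ, 0 < c ∧ ∀ t : ℝ, 0 < t → c ≤ ∫ x in Set.Ioo a b, B2 x t

/-- Hypothesis (H3): `B2(·,t)` stabilizes to `B2inf ∈ L²(Ω)` in the averaged `L²` sense. -/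
def HypH3 (a b : ℝ) (B2 : ℝ → ℝ → ℝ) (B2inf : ℝ → ℝ) : Prop :=
  MeasureTheory.MemLp B2inf 2 (MeasureTheory.volume.restrict (Set.Ioo a b)) ∧
  Filter.Tendsto
    (fun t : ℝ => ∫ s in t..(t+1), ∫ x in Set.Ioo a b, (B2 x s - B2inf x)^2)
    Filter.atTop (nhds 0)

/-- A classical solution of the urban crime system
`u_t = u_xx − χ (u/v · v_x)_x − uv + B1`, `v_t = v_xx + uv − v + B2` on
`Ω̄ × [0, Tmax)`, `Ω = (a,b)`, with homogeneous Neumann boundary conditions and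
initial data `(u0, v0)`; `u, v` are positive on `Ω̄ × (0, Tmax)`, belong to
`C⁰(Ω̄ × [0,Tmax)) ∩ C^{2,1}(Ω̄ × (0,Tmax))` and `v(·,t)` lies in `W^{1,r}(Ω)`,
continuously in `t`, for every `r > 1`. -/
structure CrimeSol (a b χ : ℝ) (B1 B2 : ℝ → ℝ → ℝ) (u0 v0 : ℝ → ℝ)
    (u v : ℝ → ℝ → ℝ) (Tmax : ℝ≥0∞) : Prop where
  u_cont : ContinuousOn (fun p : ℝ × ℝ => u p.1 p.2) ((Set.Icc a b) ×ˢ It Tmax)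
  v_cont : ContinuousOn (fun p : ℝ × ℝ => v p.1 p.2) ((Set.Icc a b) ×ˢ It Tmax)
  u_init : ∀ x ∈ Set.Icc a b, u x 0 = u0 x
  v_init : ∀ x ∈ Set.Icc a b, v x 0 = v0 x
  u_pos : ∀ x ∈ Set.Icc a b, ∀ t ∈ It' Tmax, 0 < u x t
  v_pos : ∀ x ∈ Set.Icc a b, ∀ t ∈ It' Tmax, 0 < v x t
  u_reg : ∀ x ∈ Set.Icc a b, ∀ t ∈ It' Tmax,
    DifferentiableAt ℝ (fun y => u y t) x ∧
    DifferentiableAt ℝ (fun y => pdx u y t) x ∧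
    DifferentiableAt ℝ (fun s => u x s) t
  v_reg : ∀ x ∈ Set.Icc a b, ∀ t ∈ It' Tmax,
    DifferentiableAt ℝ (fun y => v y t) x ∧
    DifferentiableAt ℝ (fun y => pdx v y t) x ∧
    DifferentiableAt ℝ (fun s => v x s) t
  u_cont21 : ContinuousOn
    (fun p : ℝ × ℝ => (pdx u p.1 p.2, pdx (pdx u) p.1 p.2, pdt u p.1 p.2))
    ((Set.Icc a b) ×ˢ It' Tmax)
  v_cont21 : ContinuousOn
    (fun p : ℝ × ℝ => (pdx v p.1 p.2, pdx (pdx v) p.1 p.2, pdt v p.1 p.2))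
    ((Set.Icc a b) ×ˢ It' Tmax)
  v_W1r : ∀ r : ℝ, 1 < r →
    (∀ t ∈ It Tmax,
      MeasureTheory.IntegrableOn (fun x => |pdx v x t| ^ r) (Set.Ioo a b)) ∧
    ContinuousOn (fun t => ∫ x in Set.Ioo a b, |pdx v x t| ^ r) (It Tmax)
  u_eq : ∀ x ∈ Set.Ioo a b, ∀ t ∈ It' Tmax,
    pdt u x t = pdx (pdx u) x t
      - χ * pdx (fun y s => u y s / v y s * pdx v y s) x t
      - u x t * v x t + B1 x t
  v_eq : ∀ x ∈ Set.Ioo a b, ∀ t ∈ It' Tmax,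
    pdt v x t = pdx (pdx v) x t + u x t * v x t - v x t + B2 x t
  u_bc : ∀ t ∈ It' Tmax, pdx u a t = 0 ∧ pdx u b t = 0
  v_bc : ∀ t ∈ It' Tmax, pdx v a t = 0 ∧ pdx v b t = 0

/-- A classical solution of the stationary Neumann problem
`−w'' + w = B` in `Ω = (a,b)`, `w' = 0` on `∂Ω`. -/
def IsStationarySol (a b : ℝ) (B : ℝ → ℝ) (w : ℝ → ℝ) : Prop :=
  ContinuousOn w (Set.Icc a b) ∧
  (∀ x ∈ Set.Icc a b, DifferentiableAt ℝ w x ∧ DifferentiableAt ℝ (deriv w) x) ∧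
  (∀ x ∈ Set.Ioo a b, -(deriv (deriv w) x) + w x = B x) ∧
  deriv w a = 0 ∧ deriv w b = 0

/-- The branches `q^±(p) = (1−p)/2 · (1 ∓/± √(1 − pχ²))`. -/
def qminus (χ p : ℝ) : ℝ := (1 - p) / 2 * (1 - Real.sqrt (1 - p * χ^2))

def qplus (χ p : ℝ) : ℝ := (1 - p) / 2 * (1 + Real.sqrt (1 - p * χ^2))

/-- The auxiliary functions `φ₁, φ₂, φ₃` and the constant `p₀`. -/
def phi1 (p : ℝ) : ℝ := (p + 1) / (1 - p)

def phi2 (χ p : ℝ) : ℝ := (1 - p) / (2 * p) * (1 + Real.sqrt (1 - p * χ^2))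

def phi3 (χ p : ℝ) : ℝ := (1 - p) / (2 * p) * (1 - Real.sqrt (1 - p * χ^2))

def p0 : ℝ := (2 * Real.sqrt 3 - 3) / 3

lemma slice_cont {g : ℝ → ℝ → ℝ} {A S : Set ℝ}
    (h : ContinuousOn (fun p : ℝ × ℝ => g p.1 p.2) (A ×ˢ S)) {t : ℝ} (ht : t ∈ S) :
    ContinuousOn (fun x => g x t) A :=
  h.comp (f := fun x : ℝ => (x, t)) (by fun_prop) (fun _ hx => ⟨hx, ht⟩)

lemma slice_cont' {g : ℝ → ℝ → ℝ} {A S : Set ℝ}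
    (h : ContinuousOn (fun p : ℝ × ℝ => g p.1 p.2) (A ×ˢ S)) {x : ℝ} (hx : x ∈ A) :
    ContinuousOn (fun t => g x t) S :=
  h.comp (f := fun t : ℝ => (x, t)) (by fun_prop) (fun _ ht => ⟨hx, ht⟩)

lemma ii_of_cont {a b : ℝ} (hab : a ≤ b) {f : ℝ → ℝ} (h : ContinuousOn f (Icc a b)) :
    IntervalIntegrable f volume a b := by
  apply ContinuousOn.intervalIntegrable
  rwa [uIcc_of_le hab]

lemma aesm_of_cont {a b : ℝ} (hab : a ≤ b) {f : ℝ → ℝ} (h : ContinuousOn f (Icc a b)) :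
    AEStronglyMeasurable f (volume.restrict (Set.uIoc a b)) := by
  rw [uIoc_of_le hab]
  exact (h.mono Ioc_subset_Icc_self).aestronglyMeasurable measurableSet_Ioc

lemma param_cont {a b s1 s2 : ℝ} (hab : a ≤ b) {f : ℝ → ℝ → ℝ}
    (hf : ContinuousOn (fun p : ℝ × ℝ => f p.1 p.2) (Icc a b ×ˢ Icc s1 s2)) :
    ContinuousOn (fun t => ∫ x in a..b, f x t) (Icc s1 s2) := by
  obtain ⟨M, hM⟩ := (isCompact_Icc.prod isCompact_Icc).exists_bound_of_continuousOn hf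
  intro t ht
  apply intervalIntegral.continuousWithinAt_of_dominated_interval (bound := fun _ => M)
  · filter_upwards [self_mem_nhdsWithin] with s hs
    exact aesm_of_cont hab (slice_cont hf hs)
  · filter_upwards [self_mem_nhdsWithin] with s hs
    refine Eventually.of_forall fun x hx => ?_
    rw [uIoc_of_le hab] at hx
    exact hM (x, s) ⟨Ioc_subset_Icc_self hx, hs⟩
  · exact intervalIntegrable_const
  · refine Eventually.of_forall fun x hx => ?_
    rw [uIoc_of_le hab] at hx
    exact slice_cont' hf (Ioc_subset_Icc_self hx) t ht

lemma param_deriv {a b s1 s2 t : ℝ} (hab : a ≤ b) {f f' : ℝ → ℝ → ℝ} (h1 : s1 < t) (h2 : t < s2)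
    (hf : ContinuousOn (fun p : ℝ × ℝ => f p.1 p.2) (Icc a b ×ˢ Icc s1 s2))
    (hf' : ContinuousOn (fun p : ℝ × ℝ => f' p.1 p.2) (Icc a b ×ˢ Icc s1 s2))
    (hd : ∀ x ∈ Icc a b, ∀ s ∈ Icc s1 s2, HasDerivAt (fun r => f x r) (f' x s) s) :
    HasDerivAt (fun s => ∫ x in a..b, f x s) (∫ x in a..b, f' x t) t := by
  obtain ⟨M, hM⟩ := (isCompact_Icc.prod isCompact_Icc).exists_bound_of_continuousOn hf'
  have hn : Icc s1 s2 ∈ 𝓝 t := Icc_mem_nhds h1 h2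
  have ht : t ∈ Icc s1 s2 := ⟨h1.le, h2.le⟩
  refine (intervalIntegral.hasDerivAt_integral_of_dominated_loc_of_deriv_le
    (F := fun s x => f x s) (F' := fun s x => f' x s) (bound := fun _ => M) hn
    ?_ ?_ ?_ ?_ ?_ ?_).2
  · filter_upwards [hn] with s hs
    exact aesm_of_cont hab (slice_cont hf hs)
  · exact ii_of_cont hab (slice_cont hf ht)
  · exact aesm_of_cont hab (slice_cont hf' ht)
  · refine Eventually.of_forall fun x hx s hs => ?_
    rw [uIoc_of_le hab] at hx
    exact hM (x, s) ⟨Ioc_subset_Icc_self hx, hs⟩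
  · exact intervalIntegrable_const
  · refine Eventually.of_forall fun x hx s hs => ?_
    rw [uIoc_of_le hab] at hx
    exact hd x (Ioc_subset_Icc_self hx) s hs

lemma hypB_cont {a b : ℝ} {B : ℝ → ℝ → ℝ} (hB : HypB a b B) (T : ℝ) :
    ContinuousOn (fun p : ℝ × ℝ => B p.1 p.2) (Icc a b ×ˢ Icc 0 T) := by
  obtain ⟨_, _, θ, hθ, h⟩ := hB
  obtain ⟨C, hC⟩ := h (Icc a b ×ˢ Icc 0 T) (isCompact_Icc.prod isCompact_Icc)
    (prod_mono le_rfl Icc_subset_Ici_self)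
  intro p hp
  rw [ContinuousWithinAt, tendsto_iff_dist_tendsto_zero]
  have hlim : Tendsto (fun q : ℝ × ℝ => C * dist q p ^ θ) (𝓝[Icc a b ×ˢ Icc 0 T] p) (𝓝 0) := by
    have h1 : Continuous (fun q : ℝ × ℝ => C * dist q p ^ θ) :=
      continuous_const.mul
        ((continuous_id.dist continuous_const).rpow_const (fun _ => Or.inr hθ.1.le))
    have := h1.tendsto p
    simp only [dist_self, Real.zero_rpow hθ.1.ne', mul_zero] at this
    exact this.mono_left nhdsWithin_le_nhds
  refine squeeze_zero' (Eventually.of_forall fun _ => dist_nonneg) ?_ hlim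
  filter_upwards [self_mem_nhdsWithin] with q hq
  rw [Real.dist_eq]
  exact hC q hq p hp

lemma It'_isOpen (Tmax : ℝ≥0∞) : IsOpen (It' Tmax) :=
  (isOpen_lt continuous_const continuous_id).inter
    (isOpen_lt ENNReal.continuous_ofReal continuous_const)

lemma It'_box {Tmax : ℝ≥0∞} {t : ℝ} (ht : t ∈ It' Tmax) :
    ∃ s1 s2, s1 < t ∧ t < s2 ∧ Icc s1 s2 ⊆ It' Tmax := by
  obtain ⟨ε, hε, h⟩ := Metric.nhds_basis_closedBall.mem_iff.1 ((It'_isOpen Tmax).mem_nhds ht)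
  rw [Real.closedBall_eq_Icc] at h
  exact ⟨t - ε, t + ε, by linarith, by linarith, h⟩

lemma It'_sub (Tmax : ℝ≥0∞) : It' Tmax ⊆ It Tmax := fun _ h => ⟨h.1.le, h.2⟩

lemma It_Icc {Tmax : ℝ≥0∞} {s t : ℝ} (hs : 0 ≤ s) (ht : t ∈ It Tmax) : Icc s t ⊆ It Tmax :=
  fun _ hr => ⟨hs.trans hr.1, (ENNReal.ofReal_le_ofReal hr.2).trans_lt ht.2⟩

lemma It_Ioo {Tmax : ℝ≥0∞} {s t : ℝ} (hs : 0 ≤ s) (ht : t ∈ It Tmax) : Ioo s t ⊆ It' Tmax :=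
  fun _ hr => ⟨hs.trans_lt hr.1, (ENNReal.ofReal_le_ofReal hr.2.le).trans_lt ht.2⟩

lemma int_deriv_zero {a b : ℝ} (hab : a ≤ b) {f f' : ℝ → ℝ}
    (hd : ∀ x ∈ Icc a b, HasDerivAt f (f' x) x) (hc : ContinuousOn f' (Icc a b))
    (ha : f a = 0) (hb : f b = 0) : ∫ x in a..b, f' x = 0 := by
  rw [intervalIntegral.integral_eq_sub_of_hasDerivAt (f := f)
    (by rwa [uIcc_of_le hab]) (ii_of_cont hab hc), ha, hb, sub_self]

/-- Pure one-dimensional estimate: a lower bound on `∫ log w`. -/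
lemma log_est {a b c : ℝ} (hab : a < b) (hc : 0 < c) {w w' B : ℝ → ℝ}
    (hd : ∀ x ∈ Icc a b, HasDerivAt w (w' x) x) (hw' : ContinuousOn w' (Icc a b))
    (hw : ∀ x ∈ Icc a b, 0 < w x) (hB : ContinuousOn B (Icc a b)) (hB0 : ∀ x, 0 ≤ B x)
    (hcB : c ≤ ∫ x in a..b, B x) :
    - ∫ x in a..b, Real.log (w x) ≤
      (b - a) * ((∫ x in a..b, B x / w x) / c + (b - a) + ∫ x in a..b, (w' x / w x) ^ 2) := by
  have hwc : ContinuousOn w (Icc a b) := HasDerivAt.continuousOn hd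
  have hw0 : ∀ x ∈ Icc a b, w x ≠ 0 := fun x hx => (hw x hx).ne'
  obtain ⟨x0, hx0, hmax⟩ := isCompact_Icc.exists_isMaxOn (nonempty_Icc.2 hab.le) hwc
  have hS := hw x0 hx0
  have hE : c / w x0 ≤ ∫ x in a..b, B x / w x := by
    calc c / w x0 ≤ (∫ x in a..b, B x) / w x0 := by gcongr
      _ = ∫ x in a..b, B x / w x0 := by rw [intervalIntegral.integral_div]
      _ ≤ _ := by
        apply intervalIntegral.integral_mono_on hab.le
        · exact ii_of_cont hab.le (hB.div_const _)
        · exact ii_of_cont hab.le (hB.div hwc hw0)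
        · intro x hx
          exact div_le_div_of_nonneg_left (hB0 x) (hw x hx) (hmax hx)
  have hE' : 1 / w x0 ≤ (∫ x in a..b, B x / w x) / c := by
    rw [le_div_iff₀ hc]; calc _ = c / w x0 := by ring
      _ ≤ _ := hE
  have hq : ContinuousOn (fun x => w' x / w x) (Icc a b) := hw'.div hwc hw0
  have hq2 : ContinuousOn (fun x => (w' x / w x) ^ 2) (Icc a b) := hq.pow 2
  have hpt : ∀ x ∈ Icc a b, - Real.log (w x) ≤
      (∫ x in a..b, B x / w x) / c + (b - a) + ∫ x in a..b, (w' x / w x) ^ 2 := by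
    intro x hx
    have hsub : uIcc x x0 ⊆ Icc a b := by
      rw [← uIcc_of_le hab.le] at hx hx0 ⊢
      exact uIcc_subset_uIcc hx hx0
    have hftc : ∫ y in x..x0, w' y / w y = Real.log (w x0) - Real.log (w x) := by
      apply intervalIntegral.integral_eq_sub_of_hasDerivAt (f := fun y => Real.log (w y))
      · intro y hy
        exact (hd y (hsub hy)).log (hw0 y (hsub hy))
      · exact (hq.mono hsub).intervalIntegrable
    have hle : |∫ y in x..x0, w' y / w y| ≤ ∫ y in a..b, (1 + (w' y / w y) ^ 2) := by
      have e1 : |∫ y in x..x0, w' y / w y| ≤ |∫ y in x..x0, (1 + (w' y / w y) ^ 2)| := by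
        have := intervalIntegral.norm_integral_le_abs_of_norm_le (a := x) (b := x0) (μ := volume)
          (f := fun y => w' y / w y) (g := fun y => 1 + (w' y / w y) ^ 2)
          (Eventually.of_forall fun y => by
            rw [Real.norm_eq_abs, abs_le]
            constructor <;> nlinarith [sq_nonneg (w' y / w y - 1), sq_nonneg (w' y / w y + 1)])
          ((continuousOn_const.add (hq.pow 2)).mono hsub).intervalIntegrable
        simpa [Real.norm_eq_abs] using this
      refine e1.trans ?_
      have e2 := intervalIntegral.abs_integral_mono_interval (μ := volume)
        (f := fun y => 1 + (w' y / w y) ^ 2) (a := x) (b := x0) (c := a) (d := b)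
        (by
          rw [uIoc_of_le hab.le]
          intro y hy
          rw [mem_uIoc] at hy
          rcases hy with hy | hy
          · exact ⟨hx.1.trans_lt hy.1, hy.2.trans hx0.2⟩
          · exact ⟨hx0.1.trans_lt hy.1, hy.2.trans hx.2⟩)
        (Eventually.of_forall fun y => by positivity)
        (ii_of_cont hab.le (continuousOn_const.add (hq.pow 2)))
      refine e2.trans (le_of_eq (abs_of_nonneg ?_))
      exact intervalIntegral.integral_nonneg hab.le (fun y _ => by positivity)
    rw [intervalIntegral.integral_add intervalIntegrable_const
      (ii_of_cont hab.le hq2), intervalIntegral.integral_const, smul_eq_mul, mul_one] at hle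
    have hl := Real.log_le_sub_one_of_pos (one_div_pos.2 hS)
    rw [one_div, Real.log_inv] at hl
    rw [one_div] at hE'
    have := le_abs_self (∫ y in x..x0, w' y / w y)
    linarith
  rw [← intervalIntegral.integral_neg]
  calc _ ≤ ∫ _x in a..b, ((∫ x in a..b, B x / w x) / c + (b - a) +
        ∫ x in a..b, (w' x / w x) ^ 2) := by
        apply intervalIntegral.integral_mono_on hab.le
        · exact ii_of_cont hab.le (hwc.log hw0).neg
        · exact intervalIntegrable_const
        · exact hpt
    _ = _ := by rw [intervalIntegral.integral_const, smul_eq_mul]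

lemma gronwall_bd {T κ C : ℝ} (hT : 0 ≤ T) (hκ : 0 < κ) {f f' : ℝ → ℝ}
    (hc : ContinuousOn f (Icc 0 T)) (hd : ∀ t ∈ Ioo 0 T, HasDerivAt f (f' t) t)
    (hle : ∀ t ∈ Ioo 0 T, f' t ≤ C - κ * f t) : f T ≤ |f 0 - C / κ| + C / κ := by
  have hD : ∀ t ∈ Ioo 0 T, HasDerivAt (fun t => Real.exp (κ * t) * (f t - C / κ))
      (Real.exp (κ * t) * (κ * 1) * (f t - C / κ) + Real.exp (κ * t) * f' t) t := by
    intro t ht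
    exact (((hasDerivAt_id t).const_mul κ).exp).mul ((hd t ht).sub_const _)
  have hanti : AntitoneOn (fun t => Real.exp (κ * t) * (f t - C / κ)) (Icc 0 T) := by
    apply antitoneOn_of_deriv_nonpos (convex_Icc _ _)
    · exact (by fun_prop : Continuous fun t => Real.exp (κ * t)).continuousOn.mul
        (hc.sub continuousOn_const)
    · rw [interior_Icc]
      exact fun t ht => (hD t ht).differentiableAt.differentiableWithinAt
    · rw [interior_Icc]
      intro t ht
      rw [(hD t ht).deriv]
      have h1 := hle t ht
      have h2 : Real.exp (κ * t) * (κ * 1) * (f t - C / κ) + Real.exp (κ * t) * f' t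
        = Real.exp (κ * t) * (f' t - (C - κ * f t)) := by field_simp; ring
      rw [h2]
      exact mul_nonpos_of_nonneg_of_nonpos (Real.exp_pos _).le (by linarith)
  have h := hanti (left_mem_Icc.2 hT) (right_mem_Icc.2 hT) hT
  simp only [mul_zero, Real.exp_zero, one_mul] at h
  have h1 : (1:ℝ) ≤ Real.exp (κ * T) := Real.one_le_exp (by positivity)
  by_cases h0 : f T - C / κ ≤ 0
  · linarith [abs_nonneg (f 0 - C / κ)]
  · push Not at h0
    have := le_abs_self (f 0 - C / κ)
    nlinarith

section pde
variable {a b χ : ℝ} {B1 B2 : ℝ → ℝ → ℝ} {u0 v0 : ℝ → ℝ} {Tmax : ℝ≥0∞} {u v : ℝ → ℝ → ℝ}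

lemma flux_deriv (hsol : CrimeSol a b χ B1 B2 u0 v0 u v Tmax) {x t : ℝ} (hx : x ∈ Icc a b)
    (ht : t ∈ It' Tmax) :
    HasDerivAt (fun y => u y t / v y t * pdx v y t)
      ((pdx u x t * v x t - u x t * pdx v x t) / v x t ^ 2 * pdx v x t
        + u x t / v x t * pdx (pdx v) x t) x := by
  obtain ⟨hu1, hu2, -⟩ := hsol.u_reg x hx t ht
  obtain ⟨hv1, hv2, -⟩ := hsol.v_reg x hx t ht
  exact (hu1.hasDerivAt.div hv1.hasDerivAt (hsol.v_pos x hx t ht).ne').mul hv2.hasDerivAt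

lemma ux_cont (hsol : CrimeSol a b χ B1 B2 u0 v0 u v Tmax) {t : ℝ} (ht : t ∈ It' Tmax) :
    ContinuousOn (fun x => u x t) (Icc a b) ∧ ContinuousOn (fun x => pdx u x t) (Icc a b) ∧
    ContinuousOn (fun x => pdx (pdx u) x t) (Icc a b) ∧
    ContinuousOn (fun x => v x t) (Icc a b) ∧ ContinuousOn (fun x => pdx v x t) (Icc a b) ∧
    ContinuousOn (fun x => pdx (pdx v) x t) (Icc a b) :=
  ⟨slice_cont hsol.u_cont (It'_sub _ ht),
    slice_cont (g := fun x t => pdx u x t) hsol.u_cont21.fst ht,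
    slice_cont (g := fun x t => pdx (pdx u) x t) hsol.u_cont21.snd.fst ht,
    slice_cont hsol.v_cont (It'_sub _ ht),
    slice_cont (g := fun x t => pdx v x t) hsol.v_cont21.fst ht,
    slice_cont (g := fun x t => pdx (pdx v) x t) hsol.v_cont21.snd.fst ht⟩

lemma flux_cont (hsol : CrimeSol a b χ B1 B2 u0 v0 u v Tmax) {t : ℝ} (ht : t ∈ It' Tmax) :
    ContinuousOn (fun x => (pdx u x t * v x t - u x t * pdx v x t) / v x t ^ 2 * pdx v x t
        + u x t / v x t * pdx (pdx v) x t) (Icc a b) := by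
  obtain ⟨c1, c2, c3, c4, c5, c6⟩ := ux_cont hsol ht
  have h0 : ∀ x ∈ Icc a b, v x t ≠ 0 := fun x hx => (hsol.v_pos x hx t ht).ne'
  exact ((((c2.mul c4).sub (c1.mul c5)).div (c4.pow 2) (fun x hx => pow_ne_zero _ (h0 x hx))).mul
    c5).add ((c1.div c4 h0).mul c6)

lemma B_slice {B : ℝ → ℝ → ℝ} (hB : HypB a b B) {t : ℝ} (ht : 0 ≤ t) :
    ContinuousOn (fun x => B x t) (Icc a b) :=
  slice_cont (hypB_cont hB t) ⟨ht, le_rfl⟩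

lemma mass_deriv (hab : a < b) (hB1 : HypB a b B1)
    (hsol : CrimeSol a b χ B1 B2 u0 v0 u v Tmax) {t : ℝ} (ht : t ∈ It' Tmax) :
    HasDerivAt (fun s => ∫ x in a..b, u x s)
      ((∫ x in a..b, B1 x t) - ∫ x in a..b, u x t * v x t) t := by
  obtain ⟨s1, s2, h1, h2, hs⟩ := It'_box ht
  have hd := param_deriv hab.le (f := u) (f' := pdt u) h1 h2
    (hsol.u_cont.mono (prod_mono le_rfl (hs.trans (It'_sub _))))
    (hsol.u_cont21.snd.snd.mono (prod_mono le_rfl hs))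
    (fun x hx s hs' => (hsol.u_reg x hx s (hs hs')).2.2.hasDerivAt)
  convert hd using 1
  obtain ⟨c1, c2, c3, c4, c5, c6⟩ := ux_cont hsol ht
  have cf := flux_cont hsol ht
  have cB := B_slice hB1 ht.1.le
  have cP : ContinuousOn (fun x => u x t * v x t) (Icc a b) := c1.mul c4
  have cBP : ContinuousOn (fun x => B1 x t - u x t * v x t) (Icc a b) := cB.sub cP
  have cz : ContinuousOn (fun x => pdx (pdx u) x t - χ * ((pdx u x t * v x t - u x t * pdx v x t) / v x t ^ 2 * pdx v x t
        + u x t / v x t * pdx (pdx v) x t)) (Icc a b) :=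
    c3.sub (continuousOn_const.mul cf)
  have hz := int_deriv_zero hab.le (f := fun y => pdx u y t - χ * (u y t / v y t * pdx v y t))
    (f' := fun x => pdx (pdx u) x t - χ * ((pdx u x t * v x t - u x t * pdx v x t) / v x t ^ 2 * pdx v x t
        + u x t / v x t * pdx (pdx v) x t))
    (fun x hx => (hsol.u_reg x hx t ht).2.1.hasDerivAt.sub
      ((flux_deriv hsol hx ht).const_mul χ)) cz
    (by simp [hsol.u_bc t ht, hsol.v_bc t ht]) (by simp [hsol.u_bc t ht, hsol.v_bc t ht])
  rw [← intervalIntegral.integral_sub (ii_of_cont hab.le cB) (ii_of_cont hab.le cP),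
    ← zero_add (∫ x in a..b, _), ← hz, ← intervalIntegral.integral_add
      (ii_of_cont hab.le cz) (ii_of_cont hab.le cBP)]
  apply intervalIntegral.integral_congr_Ioo_of_le hab.le
  intro x hx
  have hx' := Ioo_subset_Icc_self hx
  have e := hsol.u_eq x hx t ht
  have e2 : pdx (fun y s => u y s / v y s * pdx v y s) x t = _ := (flux_deriv hsol hx' ht).deriv
  rw [e2] at e
  simp only [e]
  ring

lemma v_pos' (hinit : HypInit a b u0 v0) (hsol : CrimeSol a b χ B1 B2 u0 v0 u v Tmax)
    {x t : ℝ} (hx : x ∈ Icc a b) (ht : t ∈ It Tmax) : 0 < v x t := by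
  rcases ht.1.eq_or_lt with h | h
  · rw [← h, hsol.v_init x hx]; exact hinit.2.2.2 x hx
  · exact hsol.v_pos x hx t ⟨h, ht.2⟩

lemma energy_cont (hinit : HypInit a b u0 v0) (hsol : CrimeSol a b χ B1 B2 u0 v0 u v Tmax) :
    ContinuousOn (fun p : ℝ × ℝ => u p.1 p.2 + v p.1 p.2 - Real.log (v p.1 p.2))
      (Icc a b ×ˢ It Tmax) :=
  (hsol.u_cont.add hsol.v_cont).sub
    (hsol.v_cont.log fun _ hp => (v_pos' hinit hsol hp.1 hp.2).ne')

lemma energy_deriv (hab : a < b) (hB1 : HypB a b B1) (hB2 : HypB a b B2)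
    (hinit : HypInit a b u0 v0)
    (hsol : CrimeSol a b χ B1 B2 u0 v0 u v Tmax) {t : ℝ} (ht : t ∈ It' Tmax) :
    HasDerivAt (fun s => ∫ x in a..b, (u x s + v x s - Real.log (v x s)))
      ((∫ x in a..b, B1 x t) + (∫ x in a..b, B2 x t) + (b - a) - (∫ x in a..b, u x t)
        - (∫ x in a..b, v x t) - (∫ x in a..b, (pdx v x t / v x t) ^ 2)
        - ∫ x in a..b, B2 x t / v x t) t := by
  obtain ⟨s1, s2, h1, h2, hs⟩ := It'_box ht
  have hd := param_deriv hab.le (f := fun x s => u x s + v x s - Real.log (v x s))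
    (f' := fun x s => pdt u x s + pdt v x s - pdt v x s / v x s) h1 h2
    ((energy_cont hinit hsol).mono (prod_mono le_rfl (hs.trans (It'_sub _))))
    (((hsol.u_cont21.snd.snd.add hsol.v_cont21.snd.snd).sub
      (hsol.v_cont21.snd.snd.div (hsol.v_cont.mono (prod_mono le_rfl (It'_sub _)))
        (fun p hp => (hsol.v_pos _ hp.1 _ hp.2).ne'))).mono (prod_mono le_rfl hs))
    (fun x hx s hs' => by
      have hu := (hsol.u_reg x hx s (hs hs')).2.2.hasDerivAt
      have hv := (hsol.v_reg x hx s (hs hs')).2.2.hasDerivAt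
      exact (hu.add hv).sub (hv.log (hsol.v_pos x hx s (hs hs')).ne'))
  convert hd using 1
  obtain ⟨c1, c2, c3, c4, c5, c6⟩ := ux_cont hsol ht
  have h0 : ∀ x ∈ Icc a b, v x t ≠ 0 := fun x hx => (hsol.v_pos x hx t ht).ne'
  have cf := flux_cont hsol ht
  have cB1 := B_slice hB1 ht.1.le
  have cB2 := B_slice hB2 ht.1.le
  have cE : ContinuousOn (fun x => B2 x t / v x t) (Icc a b) := cB2.div c4 h0
  have cD : ContinuousOn (fun x => (pdx v x t / v x t) ^ 2) (Icc a b) := (c5.div c4 h0).pow 2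
  have cr : ContinuousOn (fun x => (pdx (pdx v) x t * v x t - pdx v x t * pdx v x t) / v x t ^ 2)
    (Icc a b) := ((c6.mul c4).sub (c5.mul c5)).div (c4.pow 2) (fun x hx => pow_ne_zero _ (h0 x hx))
  have cz : ContinuousOn (fun x => pdx (pdx u) x t - χ * ((pdx u x t * v x t - u x t * pdx v x t) / v x t ^ 2 * pdx v x t
        + u x t / v x t * pdx (pdx v) x t) + pdx (pdx v) x t
      - (pdx (pdx v) x t * v x t - pdx v x t * pdx v x t) / v x t ^ 2) (Icc a b) :=
    ((c3.sub (continuousOn_const.mul cf)).add c6).sub cr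
  have hz := int_deriv_zero hab.le
    (f := fun y => pdx u y t - χ * (u y t / v y t * pdx v y t) + pdx v y t - pdx v y t / v y t)
    (f' := fun x => pdx (pdx u) x t - χ * ((pdx u x t * v x t - u x t * pdx v x t) / v x t ^ 2 * pdx v x t
        + u x t / v x t * pdx (pdx v) x t) + pdx (pdx v) x t
      - (pdx (pdx v) x t * v x t - pdx v x t * pdx v x t) / v x t ^ 2)
    (fun x hx => (((hsol.u_reg x hx t ht).2.1.hasDerivAt.sub
      ((flux_deriv hsol hx ht).const_mul χ)).add (hsol.v_reg x hx t ht).2.1.hasDerivAt).sub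
        ((hsol.v_reg x hx t ht).2.1.hasDerivAt.div (hsol.v_reg x hx t ht).1.hasDerivAt (h0 x hx)))
    cz
    (by simp [hsol.u_bc t ht, hsol.v_bc t ht]) (by simp [hsol.u_bc t ht, hsol.v_bc t ht])
  have hI := fun {f : ℝ → ℝ} (h : ContinuousOn f (Icc a b)) => ii_of_cont hab.le h
  have k1 : ContinuousOn (fun x => B1 x t + B2 x t) (Icc a b) := cB1.add cB2
  have k2 : ContinuousOn (fun x => B1 x t + B2 x t + 1) (Icc a b) := k1.add continuousOn_const
  have k3 : ContinuousOn (fun x => B1 x t + B2 x t + 1 - u x t) (Icc a b) := k2.sub c1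
  have k4 : ContinuousOn (fun x => B1 x t + B2 x t + 1 - u x t - v x t) (Icc a b) := k3.sub c4
  have k5 : ContinuousOn (fun x => B1 x t + B2 x t + 1 - u x t - v x t
    - (pdx v x t / v x t) ^ 2) (Icc a b) := k4.sub cD
  have k6 : ContinuousOn (fun x => B1 x t + B2 x t + 1 - u x t - v x t
    - (pdx v x t / v x t) ^ 2 - B2 x t / v x t) (Icc a b) := k5.sub cE
  have hone : b - a = ∫ _x in a..b, (1:ℝ) := by simp
  rw [hone, ← intervalIntegral.integral_add (hI cB1) (hI cB2),
    ← intervalIntegral.integral_add (hI k1) intervalIntegrable_const,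
    ← intervalIntegral.integral_sub (hI k2) (hI c1),
    ← intervalIntegral.integral_sub (hI k3) (hI c4),
    ← intervalIntegral.integral_sub (hI k4) (hI cD),
    ← intervalIntegral.integral_sub (hI k5) (hI cE),
    ← zero_add (∫ x in a..b, _), ← hz, ← intervalIntegral.integral_add (hI cz) (hI k6)]
  apply intervalIntegral.integral_congr_Ioo_of_le hab.le
  intro x hx
  have hx' := Ioo_subset_Icc_self hx
  have e := hsol.u_eq x hx t ht
  have e2 : pdx (fun y s => u y s / v y s * pdx v y s) x t = _ := (flux_deriv hsol hx' ht).deriv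
  rw [e2] at e
  have hv0 := h0 x hx'
  simp only [e, hsol.v_eq x hx t ht]
  field_simp
  ring

lemma int_B_le (hab : a < b) {B : ℝ → ℝ → ℝ} (hB : HypB a b B) {M : ℝ} (hM : ∀ x t, B x t ≤ M)
    {t : ℝ} (ht : 0 ≤ t) : ∫ x in a..b, B x t ≤ M * (b - a) := by
  calc _ ≤ ∫ _x in a..b, M := intervalIntegral.integral_mono_on hab.le
        (ii_of_cont hab.le (B_slice hB ht)) intervalIntegrable_const (fun x _ => hM x t)
    _ = _ := by rw [intervalIntegral.integral_const, smul_eq_mul]; ring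

lemma mass_bound_H2 (hab : a < b) (hB1 : HypB a b B1) (hB2 : HypB a b B2)
    (hinit : HypInit a b u0 v0) (hsol : CrimeSol a b χ B1 B2 u0 v0 u v Tmax)
    (hH2 : HypH2 a b B2) : ∃ C : ℝ, ∀ t ∈ It' Tmax, ∫ x in a..b, u x t ≤ C := by
  obtain ⟨c, hc, hcB⟩ := hH2
  obtain ⟨M1, hM1⟩ := hB1.2.1
  obtain ⟨M2, hM2⟩ := hB2.2.1
  have hL : 0 < b - a := sub_pos.2 hab
  set κ : ℝ := 1 / (1 + (b - a) + (b - a) / c) with hκ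
  have hLc : 0 < (b - a) / c := by positivity
  have hden : 0 < 1 + (b - a) + (b - a) / c := by positivity
  have hκ0 : 0 < κ := by positivity
  have hκ1 : κ ≤ 1 := by rw [hκ, div_le_one hden]; linarith
  have hκ2 : κ * (b - a) ≤ 1 := by
    rw [hκ, one_div_mul_eq_div, div_le_one hden]; linarith
  have hκ3 : κ * ((b - a) / c) ≤ 1 := by
    rw [hκ, one_div_mul_eq_div, div_le_one hden]; linarith
  set f : ℝ → ℝ := fun s => ∫ x in a..b, (u x s + v x s - Real.log (v x s)) with hf
  set C : ℝ := M1 * (b - a) + M2 * (b - a) + 2 * (b - a) with hC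
  refine ⟨|f 0 - C / κ| + C / κ, fun t ht => ?_⟩
  have hIcc : Icc 0 t ⊆ It Tmax := It_Icc le_rfl (It'_sub _ ht)
  have split : ∀ s ∈ It' Tmax, f s = (∫ x in a..b, u x s) + (∫ x in a..b, v x s)
      - ∫ x in a..b, Real.log (v x s) := by
    intro s hs
    obtain ⟨c1, -, -, c4, -⟩ := ux_cont hsol hs
    have cl : ContinuousOn (fun x => Real.log (v x s)) (Icc a b) :=
      c4.log (fun x hx => (hsol.v_pos x hx s hs).ne')
    have c14 : ContinuousOn (fun x => u x s + v x s) (Icc a b) := c1.add c4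
    rw [hf]
    simp only
    rw [intervalIntegral.integral_sub (ii_of_cont hab.le c14) (ii_of_cont hab.le cl),
      intervalIntegral.integral_add (ii_of_cont hab.le c1) (ii_of_cont hab.le c4)]
  have hG := gronwall_bd (T := t) (κ := κ) (C := C) ht.1.le hκ0 (f := f)
    (param_cont hab.le ((energy_cont hinit hsol).mono (prod_mono le_rfl hIcc)))
    (fun s hs => energy_deriv hab hB1 hB2 hinit hsol (It_Ioo le_rfl (It'_sub _ ht) hs))
    (by
      intro s hs
      have hs' := It_Ioo le_rfl (It'_sub _ ht) hs
      obtain ⟨c1, c2, c3, c4, c5, c6⟩ := ux_cont hsol hs'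
      have hcB' := hcB s hs.1
      rw [← integral_Ioc_eq_integral_Ioo, ← intervalIntegral.integral_of_le hab.le] at hcB'
      have key := log_est hab hc (w := fun x => v x s) (w' := fun x => pdx v x s)
        (B := fun x => B2 x s) (fun x hx => (hsol.v_reg x hx s hs').1.hasDerivAt) c5
        (fun x hx => hsol.v_pos x hx s hs') (B_slice hB2 hs.1.le) (fun x => hB2.1 x s) hcB'
      have b1 := int_B_le hab hB1 hM1 hs.1.le
      have b2 := int_B_le hab hB2 hM2 hs.1.le
      have pu : 0 ≤ ∫ x in a..b, u x s :=
        intervalIntegral.integral_nonneg hab.le fun x hx => (hsol.u_pos x hx s hs').le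
      have pv : 0 ≤ ∫ x in a..b, v x s :=
        intervalIntegral.integral_nonneg hab.le fun x hx => (hsol.v_pos x hx s hs').le
      have pD : 0 ≤ ∫ x in a..b, (pdx v x s / v x s) ^ 2 :=
        intervalIntegral.integral_nonneg hab.le fun x hx => sq_nonneg _
      have pE : 0 ≤ ∫ x in a..b, B2 x s / v x s :=
        intervalIntegral.integral_nonneg hab.le fun x hx =>
          div_nonneg (hB2.1 x s) (hsol.v_pos x hx s hs').le
      rw [split s hs']
      generalize (∫ x in a..b, u x s) = U at *
      generalize (∫ x in a..b, v x s) = V at *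
      generalize (∫ x in a..b, (pdx v x s / v x s) ^ 2) = D at *
      generalize (∫ x in a..b, B2 x s / v x s) = E at *
      generalize (∫ x in a..b, Real.log (v x s)) = G at *
      have k1 := mul_le_mul_of_nonneg_left key hκ0.le
      have k2 : κ * ((b - a) * (E / c + (b - a) + D))
        = (κ * ((b - a) / c)) * E + (κ * (b - a)) * (b - a) + (κ * (b - a)) * D := by
        field_simp
      have k3 := mul_le_mul_of_nonneg_right hκ3 pE
      have k4 := mul_le_mul_of_nonneg_right hκ2 hL.le
      have k5 := mul_le_mul_of_nonneg_right hκ2 pD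
      have k6 := mul_le_mul_of_nonneg_right hκ1 pu
      have k7 := mul_le_mul_of_nonneg_right hκ1 pv
      have k8 : κ * (U + V - G) = κ * U + κ * V + κ * (-G) := by ring
      rw [k8, hC]
      linarith)
  refine le_trans ?_ hG
  obtain ⟨c1, -, -, c4, -⟩ := ux_cont hsol ht
  have cl : ContinuousOn (fun x => Real.log (v x t)) (Icc a b) :=
      c4.log (fun x hx => (hsol.v_pos x hx t ht).ne')
  apply intervalIntegral.integral_mono_on hab.le (ii_of_cont hab.le c1)
    (ii_of_cont hab.le ((c1.add c4).sub cl))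
  intro x hx
  have := Real.log_le_sub_one_of_pos (hsol.v_pos x hx t ht)
  change u x t ≤ u x t + v x t - Real.log (v x t)
  linarith

lemma mass_identity (hab : a < b) (hB1 : HypB a b B1)
    (hsol : CrimeSol a b χ B1 B2 u0 v0 u v Tmax) {s t : ℝ} (hs : 0 ≤ s) (hst : s ≤ t)
    (ht : t ∈ It Tmax) :
    (∫ x in a..b, u x t) + (∫ r in s..t, ∫ x in a..b, u x r * v x r) =
      (∫ x in a..b, u x s) + ∫ r in s..t, ∫ x in a..b, B1 x r := by
  have hsub := It_Icc hs ht
  have cB : ContinuousOn (fun r => ∫ x in a..b, B1 x r) (Icc s t) :=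
    param_cont hab.le ((hypB_cont hB1 t).mono (prod_mono le_rfl (Icc_subset_Icc_left hs)))
  have cP : ContinuousOn (fun r => ∫ x in a..b, u x r * v x r) (Icc s t) :=
    param_cont (f := fun x r => u x r * v x r) hab.le
      ((hsol.u_cont.mul hsol.v_cont).mono (prod_mono le_rfl hsub))
  have h := intervalIntegral.integral_eq_sub_of_hasDerivAt_of_le hst
    (param_cont hab.le (hsol.u_cont.mono (prod_mono le_rfl hsub)))
    (fun r hr => mass_deriv hab hB1 hsol (It_Ioo hs ht hr)) (ii_of_cont hst (cB.sub cP))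
  rw [intervalIntegral.integral_sub (ii_of_cont hst cB) (ii_of_cont hst cP)] at h
  linarith

lemma absorb_nonneg (hab : a < b) (hsol : CrimeSol a b χ B1 B2 u0 v0 u v Tmax) {s t : ℝ}
    (hs : 0 ≤ s) (hst : s ≤ t) (ht : t ∈ It Tmax) :
    0 ≤ ∫ r in s..t, ∫ x in a..b, u x r * v x r := by
  rw [intervalIntegral.integral_of_le hst, integral_Ioc_eq_integral_Ioo]
  refine setIntegral_nonneg measurableSet_Ioo fun r hr => ?_
  have hr' := It_Ioo hs ht hr
  exact intervalIntegral.integral_nonneg hab.le fun x hx =>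
    (mul_pos (hsol.u_pos x hx r hr') (hsol.v_pos x hx r hr')).le

lemma mass_nonneg (hab : a < b) (hsol : CrimeSol a b χ B1 B2 u0 v0 u v Tmax) {t : ℝ}
    (ht : t ∈ It' Tmax) : 0 ≤ ∫ x in a..b, u x t :=
  intervalIntegral.integral_nonneg hab.le fun x hx => (hsol.u_pos x hx t ht).le

lemma source_le (hab : a < b) (hB1 : HypB a b B1) {M : ℝ} (hM : ∀ x t, B1 x t ≤ M) {s t : ℝ}
    (hs : 0 ≤ s) (hst : s ≤ t) :
    ∫ r in s..t, ∫ x in a..b, B1 x r ≤ (t - s) * (M * (b - a)) := by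
  calc _ ≤ ∫ _r in s..t, M * (b - a) := by
        apply intervalIntegral.integral_mono_on hst
        · exact ii_of_cont hst (param_cont hab.le
            ((hypB_cont hB1 t).mono (prod_mono le_rfl (Icc_subset_Icc_left hs))))
        · exact intervalIntegrable_const
        · exact fun r hr => int_B_le hab hB1 hM (hs.trans hr.1)
    _ = _ := by rw [intervalIntegral.integral_const, smul_eq_mul]

lemma source_le_H1 (hab : a < b) (hB1 : HypB a b B1) (hH1 : HypH1 a b B1) :
    ∃ I : ℝ, ∀ s t : ℝ, 0 ≤ s → s ≤ t → ∫ r in s..t, ∫ x in a..b, B1 x r ≤ I := by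
  refine ⟨∫ r in Ioi (0:ℝ), ∫ x in a..b, B1 x r, fun s t hs hst => ?_⟩
  have hi : IntegrableOn (fun r => ∫ x in a..b, B1 x r) (Ioi (0:ℝ)) := by
    unfold HypH1 IntegrableOn at hH1
    rw [Measure.volume_eq_prod, ← Measure.prod_restrict] at hH1
    have := hH1.integral_prod_right
    simp only [intervalIntegral.integral_of_le hab.le, integral_Ioc_eq_integral_Ioo]
    exact this
  rw [intervalIntegral.integral_of_le hst]
  apply setIntegral_mono_set hi
  · exact Eventually.of_forall fun r =>
      intervalIntegral.integral_nonneg hab.le fun x _ => hB1.1 x r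
  · exact (show Ioc s t ⊆ Ioi 0 from fun r hr => hs.trans_lt hr.1).eventuallyLE

end pde

/-- Lemma 2.4 (bounds on the total mass `∫_Ω u` and the absorption `∫∫ uv`). -/
theorem mass_and_absorption_bounds
    (a b χ : ℝ) (hab : a < b) (hχ : 0 < χ)
    (B1 B2 : ℝ → ℝ → ℝ) (hB1 : HypB a b B1) (hB2 : HypB a b B2)
    (u0 v0 : ℝ → ℝ) (hinit : HypInit a b u0 v0)
    (Tmax : ℝ≥0∞) (hT : 0 < Tmax)
    (u v : ℝ → ℝ → ℝ) (hsol : CrimeSol a b χ B1 B2 u0 v0 u v Tmax) :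
    (∀ T : ℝ, 0 < T → ∃ C : ℝ, 0 < C ∧
      ∀ t : ℝ, 0 < t → ENNReal.ofReal t < min (ENNReal.ofReal T) Tmax →
        (∫ x in Set.Ioo a b, u x t) ≤ C) ∧
    ((HypH1 a b B1 ∨ HypH2 a b B2) → ∃ C : ℝ, 0 < C ∧
      ∀ t ∈ It' Tmax, (∫ x in Set.Ioo a b, u x t) ≤ C) ∧
    (∀ T : ℝ, 0 < T → ∀ ξ : ℝ, 0 < ξ → ξ < T → ∃ K : ℝ, 0 < K ∧
      ∀ t : ℝ, 0 < t → ENNReal.ofReal (t + ξ) < min (ENNReal.ofReal T) Tmax →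
        (∫ s in t..(t+ξ), ∫ x in Set.Ioo a b, u x s * v x s) ≤ K) ∧
    (HypH2 a b B2 → ∀ ξ : ℝ, 0 < ξ → ∃ K : ℝ, 0 < K ∧
      ∀ t : ℝ, 0 < t → ENNReal.ofReal (t + ξ) < Tmax →
        (∫ s in t..(t+ξ), ∫ x in Set.Ioo a b, u x s * v x s) ≤ K) ∧
    (HypH1 a b B1 → ∃ K : ℝ, 0 < K ∧
      ∀ ξ : ℝ, 0 < ξ → ∀ t : ℝ, 0 < t → ENNReal.ofReal (t + ξ) < Tmax →
        (∫ s in t..(t+ξ), ∫ x in Set.Ioo a b, u x s * v x s) ≤ K) := by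
  have hL : 0 < b - a := sub_pos.2 hab
  obtain ⟨M, hM⟩ := hB1.2.1
  have hM0 : 0 ≤ M := (hB1.1 0 0).trans (hM 0 0)
  have hMM : 0 ≤ M * (b - a) := by positivity
  simp only [← integral_Ioc_eq_integral_Ioo, ← intervalIntegral.integral_of_le hab.le]
  set F : ℝ → ℝ := fun t => ∫ x in a..b, u x t with hF
  have hF0 : 0 ≤ F 0 := intervalIntegral.integral_nonneg hab.le fun x hx => by
    rw [hsol.u_init x hx]; exact hinit.2.1 x hx
  have mem : ∀ t : ℝ, 0 < t → ENNReal.ofReal t < Tmax → t ∈ It' Tmax := fun t h1 h2 => ⟨h1, h2⟩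
  -- mass bounded by the accumulated source
  have hmass : ∀ t ∈ It' Tmax, F t ≤ F 0 + ∫ r in (0:ℝ)..t, ∫ x in a..b, B1 x r := by
    intro t ht
    have h1 := mass_identity hab hB1 hsol le_rfl ht.1.le (It'_sub _ ht)
    have h2 := absorb_nonneg hab hsol le_rfl ht.1.le (It'_sub _ ht)
    simp only [hF]
    linarith
  have hmassT : ∀ T t : ℝ, t ≤ T → t ∈ It' Tmax → F t ≤ F 0 + T * (M * (b - a)) := by
    intro T t htT ht
    have h1 := hmass t ht
    have h2 := source_le hab hB1 hM le_rfl ht.1.le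
    have h3 := mul_le_mul_of_nonneg_right htT hMM
    rw [sub_zero] at h2
    linarith
  have habs : ∀ t ξ : ℝ, 0 < ξ → 0 < t → t + ξ ∈ It' Tmax → t ∈ It' Tmax ∧
      ∫ r in t..(t+ξ), ∫ x in a..b, u x r * v x r ≤
        F t + ∫ r in t..(t+ξ), ∫ x in a..b, B1 x r := by
    intro t ξ hξ ht h
    have h1 := mass_identity hab hB1 hsol ht.le (by linarith) (It'_sub _ h)
    have h2 := mass_nonneg hab hsol h
    exact ⟨⟨ht, (ENNReal.ofReal_le_ofReal (by linarith)).trans_lt h.2⟩, by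
      simp only [hF]; linarith⟩
  have hH2 : HypH2 a b B2 → ∃ C : ℝ, 0 < C ∧ ∀ t ∈ It' Tmax, F t ≤ C := by
    intro h
    obtain ⟨C, hC⟩ := mass_bound_H2 hab hB1 hB2 hinit hsol h
    exact ⟨max C 1, by positivity, fun t ht => (hC t ht).trans (le_max_left _ _)⟩
  refine ⟨?_, ?_, ?_, ?_, ?_⟩
  · intro T hT0
    refine ⟨F 0 + T * (M * (b - a)) + 1, by positivity, fun t ht h => ?_⟩
    obtain ⟨h1, h2⟩ := lt_min_iff.1 h
    have := hmassT T t ((ENNReal.ofReal_lt_ofReal_iff hT0).1 h1).le ⟨ht, h2⟩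
    simp only [hF] at this ⊢
    linarith
  · rintro (h | h)
    · obtain ⟨I, hI⟩ := source_le_H1 hab hB1 h
      have hI0 : 0 ≤ I := by simpa using hI 0 0 le_rfl le_rfl
      refine ⟨F 0 + I + 1, by positivity, fun t ht => ?_⟩
      have h1 := hmass t ht
      have h2 := hI 0 t le_rfl ht.1.le
      simp only [hF] at h1 ⊢
      linarith
    · exact hH2 h
  · intro T hT0 ξ hξ hξT
    refine ⟨F 0 + T * (M * (b - a)) + T * (M * (b - a)) + 1, by positivity, fun t ht h => ?_⟩
    obtain ⟨h1, h2⟩ := lt_min_iff.1 h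
    have hlt := (ENNReal.ofReal_lt_ofReal_iff hT0).1 h1
    obtain ⟨h3, h4⟩ := habs t ξ hξ ht ⟨by linarith, h2⟩
    have h5 := hmassT T t (by linarith) h3
    have h6 := source_le hab hB1 hM ht.le (show t ≤ t + ξ by linarith)
    have h7 := mul_le_mul_of_nonneg_right (show t + ξ - t ≤ T by linarith) hMM
    linarith
  · intro h ξ hξ
    obtain ⟨C, hC0, hC⟩ := hH2 h
    refine ⟨C + ξ * (M * (b - a)), by positivity, fun t ht h => ?_⟩
    obtain ⟨h3, h4⟩ := habs t ξ hξ ht ⟨by linarith, h⟩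
    have h5 := hC t h3
    have h6 := source_le hab hB1 hM ht.le (show t ≤ t + ξ by linarith)
    rw [add_sub_cancel_left] at h6
    linarith
  · intro h
    obtain ⟨I, hI⟩ := source_le_H1 hab hB1 h
    have hI0 : 0 ≤ I := by simpa using hI 0 0 le_rfl le_rfl
    refine ⟨F 0 + I + I + 1, by positivity, fun ξ hξ t ht h => ?_⟩
    obtain ⟨h3, h4⟩ := habs t ξ hξ ht ⟨by linarith, h⟩
    have h5 := hmass t h3
    have h6 := hI 0 t le_rfl ht.le
    have h7 := hI t (t + ξ) ht.le (by linarith)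
    linarith
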